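/- Let m ∈ ℕ and define the 𝒫_m-valued function E*_{m+2}(τ) = Σ_{r=0}^{m} (1/(r+1)) · binom(m,r) · e_{r,m−r}(τ) · (R_2^r E₂*)(τ). Then, with the lowering operator acting coefficientwise, L_{m+2} E*_{m+2} = (3/π) · e_{0,m}. -/

import Mathlib

open Complex

noncomputable section

/-- The upper half-plane, as a subset of `ℂ`. -/
def UH : Set ℂ := {z : ℂ | 0 < z.im}

/-- Partial derivative in the direction of the real axis, `∂f/∂u`. -/
noncomputable def du (f : ℂ → ℂ) (z : ℂ) : ℂ := fderiv ℝ f z 1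

/-- Partial derivative in the direction of the imaginary axis, `∂f/∂v`. -/
noncomputable def dv (f : ℂ → ℂ) (z : ℂ) : ℂ := fderiv ℝ f z Complex.I

/-- The Wirtinger derivative `∂_τ f = (1/2)(∂f/∂u − i ∂f/∂v)`. -/
noncomputable def dtau (f : ℂ → ℂ) (z : ℂ) : ℂ :=
  (1 / 2) * (du f z - Complex.I * dv f z)

/-- The Wirtinger derivative `∂_τ̄ f = (1/2)(∂f/∂u + i ∂f/∂v)`. -/
noncomputable def dtauBar (f : ℂ → ℂ) (z : ℂ) : ℂ :=
  (1 / 2) * (du f z + Complex.I * dv f z)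

/-- The Maass raising operator `R_k f = 2i ∂_τ f + (k/v) f`. -/
noncomputable def Rop (k : ℤ) (f : ℂ → ℂ) (z : ℂ) : ℂ :=
  2 * Complex.I * dtau f z + ((k : ℂ) / (z.im : ℂ)) * f z

/-- The Maass lowering operator `L_k f = −2i v² ∂_τ̄ f`. -/
noncomputable def Lop (_k : ℤ) (f : ℂ → ℂ) (z : ℂ) : ℂ :=
  -2 * Complex.I * (z.im : ℂ) ^ 2 * dtauBar f z

/-- The weight-`k` hyperbolic Laplacian
`Δ_k f = −v²(∂²f/∂u² + ∂²f/∂v²) + i k v (∂f/∂u + i ∂f/∂v)`. -/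
noncomputable def Lap (k : ℤ) (f : ℂ → ℂ) (z : ℂ) : ℂ :=
  -(z.im : ℂ) ^ 2 * (du (du f) z + dv (dv f) z)
    + Complex.I * (k : ℂ) * (z.im : ℂ) * (du f z + Complex.I * dv f z)

/-- Iterated raising operator `R_k^r = R_{k+2(r−1)} ∘ ⋯ ∘ R_{k+2} ∘ R_k`, `R_k^0 = id`. -/
noncomputable def Riter (k : ℤ) : ℕ → (ℂ → ℂ) → ℂ → ℂ
  | 0, f => f
  | r + 1, f => Rop (k + 2 * (r : ℤ)) (Riter k r f)

/-- Iterated lowering operator `L_k^r = L_{k−2(r−1)} ∘ ⋯ ∘ L_{k−2} ∘ L_k`, `L_k^0 = id`. -/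
noncomputable def Liter (k : ℤ) : ℕ → (ℂ → ℂ) → ℂ → ℂ
  | 0, f => f
  | r + 1, f => Lop (k - 2 * (r : ℤ)) (Liter k r f)

/-- The `𝒫_m`-valued function
`e_{r,m−r}(τ)(X) = ((−1)^{m−r}/r!) v^{r−m} (X−τ)^r (X−conj(τ))^{m−r}`,
as a polynomial in `X`. -/
noncomputable def epoly (m r : ℕ) (τ : ℂ) : Polynomial ℂ :=
  Polynomial.C ((-1 : ℂ) ^ (m - r) / (r.factorial : ℂ) * (τ.im : ℂ) ^ ((r : ℤ) - (m : ℤ))) *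
    (Polynomial.X - Polynomial.C τ) ^ r *
    (Polynomial.X - Polynomial.C ((starRingEnd ℂ) τ)) ^ (m - r)

/-- The non-holomorphic Eisenstein series
`E₂*(τ) = 1 − 24 Σ_{n≥1} σ₁(n) e^{2πinτ} − 3/(πv)`. -/
noncomputable def E2star (τ : ℂ) : ℂ :=
  1 - 24 * ∑' n : ℕ, ((∑ d ∈ n.divisors, d : ℕ) : ℂ) *
      Complex.exp (2 * (Real.pi : ℂ) * Complex.I * (n : ℂ) * τ)
    - 3 / ((Real.pi : ℂ) * (τ.im : ℂ))

/-- The `𝒫_m`-valued function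
`E*_{m+2}(τ) = Σ_{r=0}^{m} (1/(r+1)) binom(m,r) e_{r,m−r}(τ) (R_2^r E₂*)(τ)`. -/
noncomputable def Estar (m : ℕ) (τ : ℂ) : Polynomial ℂ :=
  ∑ r ∈ Finset.range (m + 1),
    Polynomial.C ((1 / ((r : ℂ) + 1)) * (m.choose r : ℂ) * Riter 2 r E2star τ) * epoly m r τ

theorem isOpen_UH : IsOpen UH := isOpen_lt continuous_const Complex.continuous_im

/-! ### Differentiability of the raising operator -/

theorem ContDiffOn.fderiv_apply_UH {f : ℂ → ℂ} (hf : ContDiffOn ℝ (⊤ : ℕ∞) f UH) (e : ℂ) :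
    ContDiffOn ℝ (⊤ : ℕ∞) (fun z => fderiv ℝ f z e) UH :=
  (hf.fderiv_of_isOpen isOpen_UH (by simp)).clm_apply contDiffOn_const

theorem contDiff_ofReal_im : ContDiff ℝ (⊤ : ℕ∞) (fun z : ℂ => (z.im : ℂ)) :=
  (Complex.ofRealCLM.comp Complex.imCLM).contDiff

theorem ofReal_im_ne_zero {z : ℂ} (hz : z ∈ UH) : (z.im : ℂ) ≠ 0 :=
  Complex.ofReal_ne_zero.2 (ne_of_gt hz)

theorem Rop_eq (k : ℤ) (f : ℂ → ℂ) :
    Rop k f = fun z => I * du f z + dv f z + (k : ℂ) * (z.im : ℂ)⁻¹ * f z := by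
  funext z
  simp only [Rop, dtau]
  linear_combination (-dv f z) * I_sq

theorem Lop_eq (k : ℤ) (f : ℂ → ℂ) :
    Lop k f = fun z => (z.im : ℂ) ^ 2 * (dv f z - I * du f z) := by
  funext z
  simp only [Lop, dtauBar]
  linear_combination (-(z.im : ℂ) ^ 2 * dv f z) * I_sq

theorem ContDiffOn.Rop {f : ℂ → ℂ} (hf : ContDiffOn ℝ (⊤ : ℕ∞) f UH) (k : ℤ) :
    ContDiffOn ℝ (⊤ : ℕ∞) (Rop k f) UH := by
  rw [Rop_eq]
  exact ((contDiffOn_const.mul (hf.fderiv_apply_UH 1)).add (hf.fderiv_apply_UH I)).add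
    ((contDiffOn_const.mul
      (contDiff_ofReal_im.contDiffOn.inv fun _ hz => ofReal_im_ne_zero hz)).mul hf)

theorem ContDiffOn.Riter {f : ℂ → ℂ} (hf : ContDiffOn ℝ (⊤ : ℕ∞) f UH) (k : ℤ) (r : ℕ) :
    ContDiffOn ℝ (⊤ : ℕ∞) (Riter k r f) UH := by
  induction r with
  | zero => exact hf
  | succ r ih => exact ih.Rop _

theorem ContDiffOn.differentiableAt_UH {f : ℂ → ℂ} (hf : ContDiffOn ℝ (⊤ : ℕ∞) f UH)
    {z : ℂ} (hz : z ∈ UH) : DifferentiableAt ℝ f z :=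
  (hf.contDiffAt (isOpen_UH.mem_nhds hz)).differentiableAt (by simp)

/-! ### The commutator of the lowering and raising operators -/

theorem hasFDerivAt_ofReal_im (z : ℂ) :
    HasFDerivAt (𝕜 := ℝ) (fun z : ℂ => (z.im : ℂ)) (Complex.ofRealCLM.comp Complex.imCLM) z :=
  (Complex.ofRealCLM.comp Complex.imCLM).hasFDerivAt

theorem hasFDerivAt_inv_ofReal_im {z : ℂ} (hz : z ∈ UH) :
    HasFDerivAt (𝕜 := ℝ) (fun z : ℂ => (z.im : ℂ)⁻¹)
      ((-((z.im : ℂ) ^ 2)⁻¹) • (Complex.ofRealCLM.comp Complex.imCLM)) z := by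
  have h := (hasDerivAt_inv (ofReal_im_ne_zero hz)).comp_hasFDerivAt (𝕜 := ℝ) z
    (hasFDerivAt_ofReal_im z)
  exact h

theorem du_dv_comm {f : ℂ → ℂ} (hf : ContDiffOn ℝ (⊤ : ℕ∞) f UH) {z : ℂ} (hz : z ∈ UH) :
    du (dv f) z = dv (du f) z := by
  have hc := hf.contDiffAt (isOpen_UH.mem_nhds hz)
  have hs : IsSymmSndFDerivAt ℝ f z := hc.isSymmSndFDerivAt (by
    simpa using WithTop.coe_le_coe.2 (le_top : (2 : ℕ∞) ≤ ⊤))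
  have hd : DifferentiableAt ℝ (fderiv ℝ f) z :=
    (hc.fderiv_right (m := 1) (by norm_cast)).differentiableAt (by simp)
  have key (a b : ℂ) : fderiv ℝ (fun w => fderiv ℝ f w a) z b = fderiv ℝ (fderiv ℝ f) z b a := by
    rw [(hd.hasFDerivAt.clm_apply (hasFDerivAt_const a z)).fderiv]
    simp
  exact (key I 1).trans ((hs 1 I).trans (key 1 I).symm)

theorem Lop_Rop {f : ℂ → ℂ} (hf : ContDiffOn ℝ (⊤ : ℕ∞) f UH) (k l l' : ℤ) {z : ℂ}
    (hz : z ∈ UH) :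
    Lop l (Rop k f) z = Rop (k - 2) (Lop l' f) z - k * f z := by
  have hy := ofReal_im_ne_zero hz
  have hY := hasFDerivAt_ofReal_im z
  have hYi := hasFDerivAt_inv_ofReal_im hz
  have hF := (hf.differentiableAt_UH hz).hasFDerivAt
  have hU : HasFDerivAt (𝕜 := ℝ) (du f) (fderiv ℝ (du f) z) z :=
    ((hf.fderiv_apply_UH 1).differentiableAt_UH hz).hasFDerivAt
  have hV : HasFDerivAt (𝕜 := ℝ) (dv f) (fderiv ℝ (dv f) z) z :=
    ((hf.fderiv_apply_UH I).differentiableAt_UH hz).hasFDerivAt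
  have hR := ((hU.const_mul I).add hV).add ((hYi.const_mul (k : ℂ)).mul hF)
  have hL := (hY.pow 2).mul (hV.sub (hU.const_mul I))
  have hRu : du (Rop k f) z = I * du (du f) z + du (dv f) z + k * (z.im : ℂ)⁻¹ * du f z := by
    rw [Rop_eq, du]
    refine (congrArg (fun A => A 1) hR.fderiv).trans ?_
    simp [du]
  have hRv : dv (Rop k f) z = I * dv (du f) z + dv (dv f) z
      + (k * (z.im : ℂ)⁻¹ * dv f z - k * ((z.im : ℂ) ^ 2)⁻¹ * f z) := by
    rw [Rop_eq, dv]
    refine (congrArg (fun A => A I) hR.fderiv).trans ?_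
    simp [dv]
    ring
  have hLu : du (Lop l' f) z = (z.im : ℂ) ^ 2 * (du (dv f) z - I * du (du f) z) := by
    rw [Lop_eq, du]
    refine (congrArg (fun A => A 1) hL.fderiv).trans ?_
    simp [du, dv]
  have hLv : dv (Lop l' f) z = (z.im : ℂ) ^ 2 * (dv (dv f) z - I * dv (du f) z)
      + 2 * z.im * (dv f z - I * du f z) := by
    rw [Lop_eq, dv]
    refine (congrArg (fun A => A I) hL.fderiv).trans ?_
    simp [du, dv]
    ring
  rw [Lop_eq, Rop_eq (k - 2)]
  simp only [hRu, hRv, hLu, hLv, du_dv_comm hf hz]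
  rw [Lop_eq]
  push_cast
  field_simp
  ring

theorem Rop_congr (k : ℤ) {f g : ℂ → ℂ} (h : ∀ z ∈ UH, f z = g z) {z : ℂ} (hz : z ∈ UH) :
    Rop k f z = Rop k g z := by
  have he : f =ᶠ[nhds z] g := Filter.eventuallyEq_of_mem (isOpen_UH.mem_nhds hz) h
  simp only [Rop, dtau, du, dv, he.fderiv_eq, he.eq_of_nhds]

theorem Rop_const_mul (k : ℤ) (c : ℂ) {f : ℂ → ℂ} {z : ℂ} (hf : DifferentiableAt ℝ f z) :
    Rop k (fun w => c * f w) z = c * Rop k f z := by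
  simp only [Rop, dtau, du, dv, fderiv_const_mul hf c]
  simp
  ring

theorem Rop_zero_const (c z : ℂ) : Rop 0 (fun _ => c) z = 0 := by
  simp [Rop, dtau, du, dv]

theorem Lop_Riter_succ {f : ℂ → ℂ} (hf : ContDiffOn ℝ (⊤ : ℕ∞) f UH) {c : ℂ}
    (hL : ∀ z ∈ UH, Lop 0 f z = c) (r : ℕ) :
    ∀ z ∈ UH, Lop 0 (Riter 2 (r + 1) f) z = -((r + 1) * (r + 2)) * Riter 2 r f z := by
  induction r with
  | zero =>
    intro z hz
    change Lop 0 (Rop (2 + 2 * ((0 : ℕ) : ℤ)) f) z = _ * f z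
    rw [Lop_Rop hf _ _ 0 hz, Rop_congr _ hL hz]
    norm_num [Rop_zero_const]
  | succ r ih =>
    intro z hz
    have hr := hf.Riter 2 r
    change Lop 0 (Rop (2 + 2 * ((r + 1 : ℕ) : ℤ)) (Riter 2 (r + 1) f)) z = _
    rw [Lop_Rop (hf.Riter 2 (r + 1)) _ _ 0 hz, Rop_congr _ ih hz,
      Rop_const_mul _ _ (hr.differentiableAt_UH hz)]
    have he : (2 + 2 * ((r + 1 : ℕ) : ℤ) - 2) = 2 + 2 * (r : ℤ) := by push_cast; ring
    rw [he]
    change _ * Riter 2 (r + 1) f z - _ = _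
    push_cast
    ring

/-! ### The lowering operator as a derivation -/

/-- `f` is real differentiable at `z` and its image under the lowering operator there is `a`. -/
def HasLopAt (f : ℂ → ℂ) (a z : ℂ) : Prop :=
  DifferentiableAt ℝ f z ∧ Lop 0 f z = a

theorem hasLopAt_const (c z : ℂ) : HasLopAt (fun _ => c) 0 z :=
  ⟨differentiableAt_const c, by simp [Lop, dtauBar, du, dv]⟩

theorem HasLopAt.add {f g : ℂ → ℂ} {a b z : ℂ} (hf : HasLopAt f a z) (hg : HasLopAt g b z) :
    HasLopAt (fun w => f w + g w) (a + b) z := by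
  refine ⟨hf.1.add hg.1, ?_⟩
  rw [← hf.2, ← hg.2]
  simp only [Lop, dtauBar, du, dv, fderiv_fun_add hf.1 hg.1]
  simp
  ring

theorem HasLopAt.mul {f g : ℂ → ℂ} {a b z : ℂ} (hf : HasLopAt f a z) (hg : HasLopAt g b z) :
    HasLopAt (fun w => f w * g w) (a * g z + f z * b) z := by
  refine ⟨hf.1.mul hg.1, ?_⟩
  rw [← hf.2, ← hg.2]
  simp only [Lop, dtauBar, du, dv, fderiv_fun_mul hf.1 hg.1]
  simp
  ring

theorem HasLopAt.sum {ι : Type*} (s : Finset ι) {f : ι → ℂ → ℂ} {a : ι → ℂ} {z : ℂ}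
    (h : ∀ i ∈ s, HasLopAt (f i) (a i) z) :
    HasLopAt (fun w => ∑ i ∈ s, f i w) (∑ i ∈ s, a i) z := by
  classical
  induction s using Finset.induction_on with
  | empty => simpa using hasLopAt_const 0 z
  | insert i s hi ih =>
    simp only [Finset.sum_insert hi]
    exact (h i (Finset.mem_insert_self i s)).add
      (ih fun j hj => h j (Finset.mem_insert_of_mem hj))

theorem hasLopAt_of_differentiableAt {f : ℂ → ℂ} {z : ℂ} (hf : DifferentiableAt ℂ f z) :
    HasLopAt f 0 z := by
  refine ⟨hf.restrictScalars ℝ, ?_⟩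
  have h := hf.hasDerivAt.hasFDerivAt.restrictScalars ℝ
  simp only [Lop, dtauBar, du, dv, h.fderiv]
  simp
  right
  linear_combination deriv f z * I_sq

theorem hasLopAt_conj (z : ℂ) :
    HasLopAt (fun w => (starRingEnd ℂ) w) (-2 * I * (z.im : ℂ) ^ 2) z := by
  have h : HasFDerivAt (𝕜 := ℝ) (fun w => (starRingEnd ℂ) w) (Complex.conjCLE : ℂ →L[ℝ] ℂ) z :=
    (Complex.conjCLE : ℂ →L[ℝ] ℂ).hasFDerivAt
  refine ⟨h.differentiableAt, ?_⟩
  simp only [Lop, dtauBar, du, dv, h.fderiv]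
  simp
  ring

theorem hasLopAt_ofReal_im_zpow (n : ℤ) {z : ℂ} (hz : z ∈ UH) :
    HasLopAt (fun w => (w.im : ℂ) ^ n) (n * (z.im : ℂ) ^ (n + 1)) z := by
  have hy := ofReal_im_ne_zero hz
  have h : HasFDerivAt (𝕜 := ℝ) (fun w : ℂ => (w.im : ℂ) ^ n)
      ((n * (z.im : ℂ) ^ (n - 1)) • (Complex.ofRealCLM.comp Complex.imCLM)) z :=
    HasDerivAt.comp_hasFDerivAt (𝕜 := ℝ) (h₂ := fun y : ℂ => y ^ n) z (hasDerivAt_zpow n _ (Or.inl hy)) (hasFDerivAt_ofReal_im z)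
  refine ⟨h.differentiableAt, ?_⟩
  simp only [Lop_eq, du, dv, h.fderiv]
  simp [zpow_sub₀ hy, zpow_add₀ hy]
  field_simp

/-- The coefficientwise version of `HasLopAt` for polynomial-valued functions. -/
def PolyHasLopAt (P : ℂ → Polynomial ℂ) (Q : Polynomial ℂ) (z : ℂ) : Prop :=
  ∀ j, HasLopAt (fun w => (P w).coeff j) (Q.coeff j) z

theorem polyHasLopAt_C {f : ℂ → ℂ} {a z : ℂ} (h : HasLopAt f a z) :
    PolyHasLopAt (fun w => Polynomial.C (f w)) (Polynomial.C a) z := by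
  intro j
  simp only [Polynomial.coeff_C]
  split_ifs
  · exact h
  · exact hasLopAt_const 0 z

theorem polyHasLopAt_const (P : Polynomial ℂ) (z : ℂ) : PolyHasLopAt (fun _ => P) 0 z :=
  fun _ => by simpa using hasLopAt_const _ z

theorem PolyHasLopAt.add {P₁ P₂ : ℂ → Polynomial ℂ} {Q₁ Q₂ : Polynomial ℂ} {z : ℂ}
    (h₁ : PolyHasLopAt P₁ Q₁ z) (h₂ : PolyHasLopAt P₂ Q₂ z) :
    PolyHasLopAt (fun w => P₁ w + P₂ w) (Q₁ + Q₂) z := by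
  intro j
  simpa only [Polynomial.coeff_add] using (h₁ j).add (h₂ j)

theorem PolyHasLopAt.mul {P₁ P₂ : ℂ → Polynomial ℂ} {Q₁ Q₂ : Polynomial ℂ} {z : ℂ}
    (h₁ : PolyHasLopAt P₁ Q₁ z) (h₂ : PolyHasLopAt P₂ Q₂ z) :
    PolyHasLopAt (fun w => P₁ w * P₂ w) (Q₁ * P₂ z + P₁ z * Q₂) z := by
  intro j
  simp only [Polynomial.coeff_add, Polynomial.coeff_mul, ← Finset.sum_add_distrib]
  exact HasLopAt.sum _ fun i _ => (h₁ i.1).mul (h₂ i.2)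

theorem PolyHasLopAt.sum {ι : Type*} (s : Finset ι) {P : ι → ℂ → Polynomial ℂ}
    {Q : ι → Polynomial ℂ} {z : ℂ} (h : ∀ i ∈ s, PolyHasLopAt (P i) (Q i) z) :
    PolyHasLopAt (fun w => ∑ i ∈ s, P i w) (∑ i ∈ s, Q i) z := by
  intro j
  simp only [Polynomial.finsetSum_coeff]
  exact HasLopAt.sum _ fun i hi => h i hi j

theorem PolyHasLopAt.pow {P : ℂ → Polynomial ℂ} {Q : Polynomial ℂ} {z : ℂ}
    (h : PolyHasLopAt P Q z) (n : ℕ) :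
    PolyHasLopAt (fun w => P w ^ n) ((n : Polynomial ℂ) * P z ^ (n - 1) * Q) z := by
  induction n with
  | zero => simpa using polyHasLopAt_const 1 z
  | succ n ih =>
    simp only [pow_succ]
    convert ih.mul h using 1
    cases n with
    | zero => simp
    | succ n => push_cast; ring

theorem polyHasLopAt_X_sub_C {f : ℂ → ℂ} {a z : ℂ} (h : HasLopAt f a z) :
    PolyHasLopAt (fun w => Polynomial.X - Polynomial.C (f w)) (-Polynomial.C a) z := by
  have h' := (polyHasLopAt_const Polynomial.X z).add
    ((polyHasLopAt_const (-1) z).mul (polyHasLopAt_C h))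
  simpa [sub_eq_add_neg] using h'

theorem polyHasLopAt_epoly {m r : ℕ} (hr : r ≤ m) {z : ℂ} (hz : z ∈ UH) :
    PolyHasLopAt (epoly m r) (Polynomial.C (((r : ℂ) + 1) * ((m : ℂ) - r)) * epoly m (r + 1) z) z := by
  have hy := ofReal_im_ne_zero hz
  have h := ((polyHasLopAt_C ((hasLopAt_const ((-1 : ℂ) ^ (m - r) / (r.factorial : ℂ)) z).mul
    (hasLopAt_ofReal_im_zpow ((r : ℤ) - (m : ℤ)) hz))).mul
    ((polyHasLopAt_X_sub_C (hasLopAt_of_differentiableAt differentiableAt_id)).pow r)).mul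
    ((polyHasLopAt_X_sub_C (hasLopAt_conj z)).pow (m - r))
  refine (congrArg (fun Q => PolyHasLopAt (epoly m r) Q z) ?_).mpr h
  obtain ⟨n, rfl⟩ := Nat.exists_eq_add_of_le hr
  have hconj : (starRingEnd ℂ) z = z - 2 * I * z.im := by
    apply Complex.ext <;> simp; ring
  cases n with
  | zero => simp
  | succ n =>
    have h1 : r + (n + 1) - (r + 1) = n := by omega
    have h2 : r + (n + 1) - r = n + 1 := by omega
    have h3 : (r : ℤ) - ((r + (n + 1) : ℕ) : ℤ) = -(n : ℤ) - 1 := by push_cast; ring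
    have h4 : ((r + 1 : ℕ) : ℤ) - ((r + (n + 1) : ℕ) : ℤ) = -(n : ℤ) := by push_cast; ring
    simp only [epoly, h1, h2, h3, h4, Nat.add_sub_cancel, hconj]
    set a : ℂ := (-1) ^ n / (r.factorial : ℂ) * (z.im : ℂ) ^ (-(n : ℤ)) with ha
    have e1 : (-1 : ℂ) ^ n / ((r + 1).factorial : ℂ) * (z.im : ℂ) ^ (-(n : ℤ)) = a / (r + 1) := by
      rw [ha, Nat.factorial_succ]
      push_cast
      field_simp
    have e2 : (-1 : ℂ) ^ (n + 1) / (r.factorial : ℂ) *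
        (((-(n : ℤ) - 1 : ℤ) : ℂ) * (z.im : ℂ) ^ (-(n : ℤ) - 1 + 1)) = a * (n + 1) := by
      rw [ha, sub_add_cancel]
      push_cast
      ring
    have e3 : (-1 : ℂ) ^ (n + 1) / (r.factorial : ℂ) * (z.im : ℂ) ^ (-(n : ℤ) - 1)
        = -(a * (z.im : ℂ)⁻¹) := by
      rw [ha, zpow_sub_one₀ hy]
      ring
    have e4 : Polynomial.C (z.im : ℂ)⁻¹ * Polynomial.C (z.im : ℂ) = 1 := by
      rw [← Polynomial.C_mul, inv_mul_cancel₀ hy, Polynomial.C_1]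
    have hr1 : (r : ℂ) + 1 ≠ 0 := by exact_mod_cast r.succ_ne_zero
    have e5 : ((r : ℂ) + 1) * (((r + (n + 1) : ℕ) : ℂ) - r) * (a / (r + 1)) = a * (n + 1) := by
      push_cast
      field_simp
      ring
    rw [e1, e2, e3, ← mul_assoc, ← mul_assoc, ← Polynomial.C_mul, e5]
    simp only [Polynomial.C_mul, Polynomial.C_sub, Polynomial.C_neg, Polynomial.C_add,
      Polynomial.C_0, Polynomial.C_1, Polynomial.C_pow, Polynomial.C_eq_natCast, id, zero_mul]
    push_cast
    set A := Polynomial.C a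
    set Y := Polynomial.C (z.im : ℂ)
    set Z := Polynomial.C (z.im : ℂ)⁻¹
    set V := Polynomial.X - (Polynomial.C z - Polynomial.C 2 * Polynomial.C I * Y)
    linear_combination ((Polynomial.X - Polynomial.C z) ^ r * A * V ^ n * (n + 1) *
      Polynomial.C 2 * Polynomial.C I * Y) * e4

/-! ### The Eisenstein series of weight two -/

theorem differentiableOn_tsum_sigma :
    DifferentiableOn ℂ (fun τ : ℂ => ∑' n : ℕ, ((∑ d ∈ n.divisors, d : ℕ) : ℂ) *
      Complex.exp (2 * (Real.pi : ℂ) * Complex.I * (n : ℂ) * τ)) UH := by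
  intro z hz
  have hz' : 0 < z.im := hz
  set ε := z.im / 2 with hε
  have hε0 : 0 < ε := by positivity
  have hU : IsOpen {w : ℂ | ε < w.im} := isOpen_lt continuous_const Complex.continuous_im
  refine DifferentiableAt.differentiableWithinAt ?_
  refine (differentiableOn_tsum_of_summable_norm
    (u := fun n : ℕ => (n : ℝ) ^ 2 * Real.exp (-(2 * Real.pi * ε)) ^ n) ?_ ?_ hU ?_).differentiableAt
    (hU.mem_nhds (show ε < z.im by linarith))
  · refine summable_pow_mul_geometric_of_norm_lt_one 2 ?_
    rw [Real.norm_of_nonneg (Real.exp_nonneg _), Real.exp_lt_one_iff]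
    have := Real.pi_pos
    nlinarith [mul_pos this hε0]
  · intro n
    fun_prop
  · intro n w hw
    have hw' : ε < w.im := hw
    rw [norm_mul, Complex.norm_natCast, Complex.norm_exp, ← Real.exp_nat_mul]
    gcongr
    · have : ∑ d ∈ n.divisors, d ≤ n ^ 2 := by
        calc ∑ d ∈ n.divisors, d ≤ ∑ _d ∈ n.divisors, n :=
              Finset.sum_le_sum fun d hd => Nat.divisor_le hd
          _ = n.divisors.card * n := by simp
          _ ≤ n * n := Nat.mul_le_mul_right _ (Nat.card_divisors_le_self n)
          _ = n ^ 2 := by ring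
      exact_mod_cast this
    · simp
      have : 0 ≤ 2 * Real.pi * (n : ℝ) := by positivity
      nlinarith [mul_le_mul_of_nonneg_left hw'.le this]

theorem E2star_eq (τ : ℂ) : E2star τ =
    (1 + -24 * ∑' n : ℕ, ((∑ d ∈ n.divisors, d : ℕ) : ℂ) *
      Complex.exp (2 * (Real.pi : ℂ) * Complex.I * (n : ℂ) * τ))
    + -(3 / (Real.pi : ℂ)) * (τ.im : ℂ) ^ (-1 : ℤ) := by
  rw [E2star, zpow_neg_one]
  ring

theorem differentiableOn_E2star_holomorphic_part :
    DifferentiableOn ℂ (fun τ : ℂ => 1 + -24 * ∑' n : ℕ, ((∑ d ∈ n.divisors, d : ℕ) : ℂ) *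
      Complex.exp (2 * (Real.pi : ℂ) * Complex.I * (n : ℂ) * τ)) UH :=
  (differentiableOn_const _).add ((differentiableOn_const _).mul differentiableOn_tsum_sigma)

theorem contDiffOn_E2star : ContDiffOn ℝ (⊤ : ℕ∞) E2star UH := by
  rw [funext E2star_eq]
  simp only [zpow_neg_one]
  exact ((differentiableOn_E2star_holomorphic_part.contDiffOn isOpen_UH).restrict_scalars ℝ).add
    (contDiffOn_const.mul
      (contDiff_ofReal_im.contDiffOn.inv fun _ hz => ofReal_im_ne_zero hz))

theorem Lop_E2star {z : ℂ} (hz : z ∈ UH) : Lop 0 E2star z = 3 / (Real.pi : ℂ) := by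
  have h := (hasLopAt_of_differentiableAt
    (differentiableOn_E2star_holomorphic_part.differentiableAt (isOpen_UH.mem_nhds hz))).add
    ((hasLopAt_const (-(3 / (Real.pi : ℂ))) z).mul (hasLopAt_ofReal_im_zpow (-1) hz))
  rw [funext E2star_eq, h.2]
  simp

theorem polyHasLopAt_Estar (m : ℕ) {z : ℂ} (hz : z ∈ UH) :
    PolyHasLopAt (Estar m) (Polynomial.C (3 / (Real.pi : ℂ)) * epoly m 0 z) z := by
  have hg (r : ℕ) : HasLopAt (Riter 2 r E2star) (Lop 0 (Riter 2 r E2star) z) z :=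
    ⟨(contDiffOn_E2star.Riter 2 r).differentiableAt_UH hz, rfl⟩
  have h := PolyHasLopAt.sum (Finset.range (m + 1)) fun r hr =>
    (polyHasLopAt_C ((hasLopAt_const ((1 / ((r : ℂ) + 1)) * (m.choose r : ℂ)) z).mul (hg r))).mul
      (polyHasLopAt_epoly (Nat.lt_succ_iff.1 (Finset.mem_range.1 hr)) hz)
  refine (congrArg (fun Q => PolyHasLopAt (Estar m) Q z) ?_).mpr h
  rw [Finset.sum_add_distrib, Finset.sum_range_succ', Finset.sum_range_succ _ m]
  have h0 : Lop 0 (Riter 2 0 E2star) z = 3 / (Real.pi : ℂ) := Lop_E2star hz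
  simp only [h0, Lop_Riter_succ contDiffOn_E2star (fun w hw => Lop_E2star hw) _ z hz]
  have hcancel (r : ℕ) (hr : r ∈ Finset.range m) :
      Polynomial.C (0 * Riter 2 (r + 1) E2star z + 1 / (((r + 1 : ℕ) : ℂ) + 1) *
        (m.choose (r + 1) : ℂ) * (-((r + 1) * (r + 2)) * Riter 2 r E2star z)) * epoly m (r + 1) z
      = -(Polynomial.C (1 / ((r : ℂ) + 1) * (m.choose r : ℂ) * Riter 2 r E2star z) *
        (Polynomial.C (((r : ℂ) + 1) * ((m : ℂ) - r)) * epoly m (r + 1) z)) := by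
    have hch : (m.choose (r + 1) : ℂ) * (r + 1) = m.choose r * ((m : ℂ) - r) := by
      rw [← Nat.cast_sub (Finset.mem_range.1 hr).le]
      exact_mod_cast Nat.choose_succ_right_eq m r
    have hr1 : (r : ℂ) + 1 ≠ 0 := by exact_mod_cast r.succ_ne_zero
    have hr2 : (r : ℂ) + 1 + 1 ≠ 0 := by exact_mod_cast (r + 1).succ_ne_zero
    rw [← mul_assoc (Polynomial.C _) (Polynomial.C _), ← Polynomial.C_mul,
      ← neg_mul (Polynomial.C (_ : ℂ)), ← Polynomial.C_neg]
    congr 2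
    push_cast
    field_simp
    linear_combination (-(r + 2) * Riter 2 r E2star z) * hch
  rw [Finset.sum_congr rfl hcancel, Finset.sum_neg_distrib]
  simp

/-- with the lowering operator acting coefficientwise,
`L_{m+2} E*_{m+2} = (3/π) e_{0,m}`. -/
theorem stmt16 (m : ℕ) :
    ∀ j : ℕ, ∀ τ ∈ UH,
      Lop ((m : ℤ) + 2) (fun z => (Estar m z).coeff j) τ
        = (3 / (Real.pi : ℂ)) * (epoly m 0 τ).coeff j := by
  intro j τ hτ
  rw [← Polynomial.coeff_C_mul]
  exact (polyHasLopAt_Estar m hτ j).2
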